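/- Let K be a field, let q ∈ K be a primitive e-th root of unity with 3 ≤ e < ∞, and let f be an integer with 0 ≤ f and 2f ≤ e. If n ≥ e then the Iwahori–Hecke algebra H_q(B_n) has infinite representation type. -/

import Mathlib

/-- A finite-dimensional right `A`-module, where `A` is a `K`-algebra.
Right modules are modules over the opposite ring `Aᵐᵒᵖ`. -/
structure FDRightModule (K A : Type) [Field K] [Ring A] [Algebra K A] : Type 1 where
  carrier : Type
  [isAddCommGroup : AddCommGroup carrier]
  [isModuleK : Module K carrier]
  [isModuleA : Module Aᵐᵒᵖ carrier]
  [isTower : IsScalarTower K Aᵐᵒᵖ carrier]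
  [isFinDim : FiniteDimensional K carrier]

attribute [instance] FDRightModule.isAddCommGroup FDRightModule.isModuleK
  FDRightModule.isModuleA FDRightModule.isTower FDRightModule.isFinDim

/-- A module is indecomposable if it is nonzero and is not the (internal) direct
sum of two nonzero submodules. -/
def IsIndecomposableModule (R M : Type*) [Ring R] [AddCommGroup M] [Module R M] : Prop :=
  Nontrivial M ∧ ∀ N₁ N₂ : Submodule R M, IsCompl N₁ N₂ → N₁ = ⊥ ∨ N₂ = ⊥

/-- A `K`-algebra `A` has finite representation type if there are only finitely many
isomorphism classes of indecomposable finite-dimensional right `A`-modules. -/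
def HasFiniteRepresentationType (K A : Type) [Field K] [Ring A] [Algebra K A] : Prop :=
  Finite (Quot fun M N : {M : FDRightModule K A // IsIndecomposableModule Aᵐᵒᵖ M.carrier} =>
    Nonempty (M.1.carrier ≃ₗ[Aᵐᵒᵖ] N.1.carrier))
/-- The defining relations of the Iwahori--Hecke algebra of type `Bₙ` with generators
`T_0, …, T_{n-1}`, where `T_0` satisfies `(T_0 - α)(T_0 - β) = 0` and the other
generators satisfy `(T_i + 1)(T_i - q) = 0`. -/
inductive HeckeBRel (K : Type) [Field K] (α β q : K) (n : ℕ) :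
    FreeAlgebra K (Fin n) → FreeAlgebra K (Fin n) → Prop
  | quad_zero (i : Fin n) (hi : (i : ℕ) = 0) :
      HeckeBRel K α β q n
        ((FreeAlgebra.ι K i - algebraMap K (FreeAlgebra K (Fin n)) α) *
          (FreeAlgebra.ι K i - algebraMap K (FreeAlgebra K (Fin n)) β)) 0
  | quad (i : Fin n) (hi : 0 < (i : ℕ)) :
      HeckeBRel K α β q n
        ((FreeAlgebra.ι K i + 1) * (FreeAlgebra.ι K i - algebraMap K (FreeAlgebra K (Fin n)) q)) 0
  | braid_zero (i j : Fin n) (hi : (i : ℕ) = 0) (hj : (j : ℕ) = 1) :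
      HeckeBRel K α β q n
        (FreeAlgebra.ι K i * FreeAlgebra.ι K j * FreeAlgebra.ι K i * FreeAlgebra.ι K j)
        (FreeAlgebra.ι K j * FreeAlgebra.ι K i * FreeAlgebra.ι K j * FreeAlgebra.ι K i)
  | braid (i j : Fin n) (hi : 0 < (i : ℕ)) (hij : (j : ℕ) = (i : ℕ) + 1) :
      HeckeBRel K α β q n
        (FreeAlgebra.ι K j * FreeAlgebra.ι K i * FreeAlgebra.ι K j)
        (FreeAlgebra.ι K i * FreeAlgebra.ι K j * FreeAlgebra.ι K i)
  | comm (i j : Fin n) (hij : (i : ℕ) + 1 < (j : ℕ)) :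
      HeckeBRel K α β q n (FreeAlgebra.ι K i * FreeAlgebra.ι K j)
        (FreeAlgebra.ι K j * FreeAlgebra.ι K i)

/-- The Iwahori--Hecke algebra of type `Bₙ`: the quotient of the free algebra on
`T_0, …, T_{n-1}` by the two-sided ideal generated by the defining relations, where
`T_0` satisfies `(T_0 - α)(T_0 - β) = 0`. -/
abbrev HeckeB (K : Type) [Field K] (α β q : K) (n : ℕ) : Type := RingQuot (HeckeBRel K α β q n)

section Filtration

variable {K M N : Type*} [Field K] [AddCommGroup M] [Module K M] [AddCommGroup N] [Module K N]

/-- The Jucys–Murphy operators attached to a sequence of operators `T₀, T₁, …`. -/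
def jucysMurphy (q : K) (T : ℕ → Module.End K M) : ℕ → Module.End K M
  | 0 => T 0
  | k + 1 => q⁻¹ • (T (k + 1) * jucysMurphy q T k * T (k + 1))

/-- The common kernel of the operators `(X_k - q ^ k) ^ 2` for `k < e`, where the `X_k` are the
Jucys–Murphy operators. -/
def trivialWeightSpace (q : K) (e : ℕ) (T : ℕ → Module.End K M) : Submodule K M :=
  ⨅ k : Fin e, LinearMap.ker ((jucysMurphy q T k - q ^ (k : ℕ) • 1) ^ 2)

/-- The increasing chain of subspaces obtained from `0` by iterating the linear relation
`{(v, v') | (X_{e-1} - q ^ (e-1)) v = (X_f - q ^ f) v'}` on the trivial weight space. -/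
def relationChain (q : K) (e f : ℕ) (T : ℕ → Module.End K M) : ℕ → Submodule K M
  | 0 => ⊥
  | k + 1 => trivialWeightSpace q e T ⊓
      ((relationChain q e f T k).map (jucysMurphy q T f - q ^ f • 1)).comap
        (jucysMurphy q T (e - 1) - q ^ (e - 1) • 1)

theorem relationChain_le_succ (q : K) (e f : ℕ) (T : ℕ → Module.End K M) (k : ℕ) :
    relationChain q e f T k ≤ relationChain q e f T (k + 1) := by
  induction k with
  | zero => exact bot_le
  | succ k ih => exact inf_le_inf_left _ (Submodule.comap_mono (Submodule.map_mono ih))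

theorem relationChain_eq_succ_of_finrank_le [FiniteDimensional K M] (q : K) (e f : ℕ)
    (T : ℕ → Module.End K M) {d : ℕ} (hd : Module.finrank K M ≤ d) :
    relationChain q e f T (d + 1) = relationChain q e f T d := by
  have key : ∀ j, relationChain q e f T (j + 1) = relationChain q e f T j ∨
      j + 1 ≤ Module.finrank K (relationChain q e f T (j + 1)) := by
    intro j
    induction j with
    | zero =>
      by_cases h : relationChain q e f T (0 + 1) = relationChain q e f T 0
      · exact Or.inl h
      · exact Or.inr (Submodule.one_le_finrank_iff.mpr h)
    | succ j ih =>
      by_cases h : relationChain q e f T (j + 1 + 1) = relationChain q e f T (j + 1)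
      · exact Or.inl h
      · have h₁ : relationChain q e f T (j + 1) ≠ relationChain q e f T j := by
          intro h₂
          apply h
          rw [relationChain, h₂]
          exact h₂
        have h₃ := Submodule.finrank_lt_finrank_of_lt
          (lt_of_le_of_ne (relationChain_le_succ q e f T (j + 1)) (Ne.symm h))
        have h₄ := ih.resolve_left h₁
        exact Or.inr (by omega)
  refine (key d).resolve_right fun h => ?_
  have := Submodule.finrank_le (relationChain q e f T (d + 1))
  omega

variable {T : ℕ → Module.End K M} {T' : ℕ → Module.End K N} {e : ℕ} {φ : M →ₗ[K] N}

theorem map_jucysMurphy (q : K) (hφ : ∀ k < e, ∀ v, φ (T k v) = T' k (φ v)) :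
    ∀ k < e, ∀ v, φ (jucysMurphy q T k v) = jucysMurphy q T' k (φ v) := by
  intro k
  induction k with
  | zero => exact fun hk v => hφ 0 hk v
  | succ k ih =>
    intro hk v
    simp [jucysMurphy, hφ _ hk, ih (by omega)]

theorem map_mem_trivialWeightSpace (q : K) (hφ : ∀ k < e, ∀ v, φ (T k v) = T' k (φ v)) {v : M}
    (hv : v ∈ trivialWeightSpace q e T) : φ v ∈ trivialWeightSpace q e T' := by
  rw [trivialWeightSpace, Submodule.mem_iInf] at hv ⊢
  intro k
  have := congrArg φ (hv k)
  simpa [pow_two, map_jucysMurphy q hφ _ k.2] using this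

theorem map_mem_relationChain (q : K) {f : ℕ} (hf : f < e)
    (hφ : ∀ k < e, ∀ v, φ (T k v) = T' k (φ v)) {k : ℕ} {v : M}
    (hv : v ∈ relationChain q e f T k) : φ v ∈ relationChain q e f T' k := by
  induction k generalizing v with
  | zero =>
    have : v = 0 := hv
    simp [this]
  | succ k ih =>
    obtain ⟨h₁, v', h₂, h₃⟩ := hv
    refine ⟨map_mem_trivialWeightSpace q hφ h₁, φ v', ih h₂, ?_⟩
    have := congrArg φ h₃
    simpa [map_jucysMurphy q hφ f hf, map_jucysMurphy q hφ (e - 1) (by omega)] using this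

end Filtration

section FiniteType

variable {K A : Type} [Field K] [Ring A] [Algebra K A]

theorem HasFiniteRepresentationType.exists_finrank_le (h : HasFiniteRepresentationType K A) :
    ∃ d : ℕ, ∀ M : FDRightModule K A, IsIndecomposableModule Aᵐᵒᵖ M.carrier →
      Module.finrank K M.carrier ≤ d := by
  let r := fun M N : {M : FDRightModule K A // IsIndecomposableModule Aᵐᵒᵖ M.carrier} =>
    Nonempty (M.1.carrier ≃ₗ[Aᵐᵒᵖ] N.1.carrier)
  have : Finite (Quot r) := h
  let dim : Quot r → ℕ := Quot.lift (fun M => Module.finrank K M.1.carrier) (by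
    rintro M N ⟨φ⟩
    exact (φ.restrictScalars K).finrank_eq)
  obtain ⟨d, hd⟩ := (Set.finite_range dim).bddAbove
  exact ⟨d, fun M hM => hd ⟨Quot.mk r ⟨M, hM⟩, rfl⟩⟩

/-- The operators by which a sequence of elements of `A` acts on a right `A`-module. -/
def FDRightModule.operators (M : FDRightModule K A) (a : ℕ → A) (k : ℕ) :
    Module.End K M.carrier :=
  Algebra.lsmul K K M.carrier (MulOpposite.op (a k))

/-- A submodule of a finite-dimensional right module. -/
def FDRightModule.ofSubmodule (M : FDRightModule K A) (N : Submodule Aᵐᵒᵖ M.carrier) :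
    FDRightModule K A where
  carrier := N
  isFinDim := inferInstanceAs (FiniteDimensional K (N.restrictScalars K))

theorem FDRightModule.relationChain_succ_le {d : ℕ}
    (hd : ∀ M : FDRightModule K A, IsIndecomposableModule Aᵐᵒᵖ M.carrier →
      Module.finrank K M.carrier ≤ d) (a : ℕ → A) (q : K) {e f : ℕ} (hf : f < e)
    (M : FDRightModule K A) :
    relationChain q e f (M.operators a) (d + 1) ≤ relationChain q e f (M.operators a) d := by
  induction hm : Module.finrank K M.carrier using Nat.strong_induction_on generalizing M with
  | _ m ih =>
  by_cases hM : IsIndecomposableModule Aᵐᵒᵖ M.carrier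
  · exact (relationChain_eq_succ_of_finrank_le q e f _ (hd M hM)).le
  rcases subsingleton_or_nontrivial M.carrier with hs | hs
  · intro v _
    rw [Subsingleton.elim v 0]
    exact zero_mem _
  simp only [IsIndecomposableModule, not_and, not_forall, not_or] at hM
  obtain ⟨N₁, N₂, hN, h₁, h₂⟩ := hM hs
  have part : ∀ N N' : Submodule Aᵐᵒᵖ M.carrier, ∀ h : IsCompl N N', N' ≠ ⊥ → ∀ v,
      v ∈ relationChain q e f (M.operators a) (d + 1) →
      (N.projectionOnto N' h v : M.carrier) ∈ relationChain q e f (M.operators a) d := by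
    intro N N' h h' v hv
    have hlt : Module.finrank K (M.ofSubmodule N).carrier < m := by
      rw [← hm]
      refine Submodule.finrank_lt (s := N.restrictScalars K) ?_
      rw [Ne, Submodule.restrictScalars_eq_top_iff]
      rintro rfl
      exact h' (by simpa using h.disjoint)
    have h₃ := ih _ hlt (M.ofSubmodule N) rfl
    have h₄ := map_mem_relationChain (T' := (M.ofSubmodule N).operators a)
      (φ := (N.projectionOnto N' h).restrictScalars K) q hf
      (fun k _ v => (N.projectionOnto N' h).map_smul _ _) hv
    exact map_mem_relationChain (T := (M.ofSubmodule N).operators a)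
      (φ := N.subtype.restrictScalars K) q hf (fun k _ v => rfl) (h₃ h₄)
  intro v hv
  rw [← Submodule.projection_add_projection_eq_self hN v]
  exact add_mem (part N₁ N₂ hN h₂ v hv) (part N₂ N₁ hN.symm h₁ v hv)

end FiniteType

section HeckeRepresentations

/-- The operators `T₀, …, T_{n-1}` on `M` satisfy the defining relations of the Iwahori–Hecke
algebra of type `Bₙ`. -/
structure IsHeckeBRep {K M : Type*} [Field K] [AddCommGroup M] [Module K M] (α β q : K) (n : ℕ)
    (T : ℕ → Module.End K M) : Prop where
  quad_zero : 0 < n → ∀ v, T 0 (T 0 v) = (α + β) • T 0 v - (α * β) • v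
  quad : ∀ i, 0 < i → i < n → ∀ v, T i (T i v) = (q - 1) • T i v + q • v
  braid_zero : 1 < n → ∀ v, T 0 (T 1 (T 0 (T 1 v))) = T 1 (T 0 (T 1 (T 0 v)))
  braid : ∀ i, 0 < i → i + 1 < n → ∀ v,
    T (i + 1) (T i (T (i + 1) v)) = T i (T (i + 1) (T i v))
  comm : ∀ i j, i + 1 < j → j < n → ∀ v, T i (T j v) = T j (T i v)

variable {K : Type} [Field K] {α β q : K} {n : ℕ}

section toModule

variable {M : Type} [AddCommGroup M] [Module K M] {T : ℕ → Module.End K M}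

theorem IsHeckeBRep.lift_rel (hT : IsHeckeBRep α β q n T) {x y : FreeAlgebra K (Fin n)}
    (h : HeckeBRel K α β q n x y) :
    FreeAlgebra.lift K (fun i : Fin n => MulOpposite.op (T i)) x =
      FreeAlgebra.lift K (fun i : Fin n => MulOpposite.op (T i)) y := by
  apply MulOpposite.unop_injective
  ext v
  cases h with
  | quad_zero i hi =>
    have := hT.quad_zero (by omega) v
    simp [hi, this]
    module
  | quad i hi =>
    have := hT.quad i hi i.2 v
    simp [this]
    module
  | braid_zero i j hi hj =>
    have := hT.braid_zero (by omega) v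
    simp [hi, hj, this]
  | braid i j hi hij =>
    have := hT.braid i hi (by omega) v
    simp [hij, this]
  | comm i j hij =>
    have := hT.comm i j hij j.2 v
    simp [this]

/-- The algebra homomorphism attached to operators satisfying the Hecke relations. -/
def IsHeckeBRep.algHom (hT : IsHeckeBRep α β q n T) :
    (HeckeB K α β q n)ᵐᵒᵖ →ₐ[K] Module.End K M :=
  AlgHom.opComm (RingQuot.liftAlgHom K ⟨FreeAlgebra.lift K fun i : Fin n => MulOpposite.op (T i),
    fun _ _ h => hT.lift_rel h⟩)

/-- The image of `T_k` in the Hecke algebra, which is taken to be `0` if `n ≤ k`. -/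
def heckeBGenerator (α β q : K) (n k : ℕ) : HeckeB K α β q n :=
  if h : k < n then RingQuot.mkAlgHom K _ (FreeAlgebra.ι K ⟨k, h⟩) else 0

theorem IsHeckeBRep.algHom_generator (hT : IsHeckeBRep α β q n T) {k : ℕ} (hk : k < n) :
    hT.algHom (MulOpposite.op (heckeBGenerator α β q n k)) = T k := by
  simp [algHom, heckeBGenerator, hk, AlgHom.opComm]

/-- The right module attached to operators satisfying the Hecke relations. -/
def IsHeckeBRep.toFDRightModule [FiniteDimensional K M] (hT : IsHeckeBRep α β q n T) :
    FDRightModule K (HeckeB K α β q n) :=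
  letI : Module (HeckeB K α β q n)ᵐᵒᵖ M := Module.compHom M hT.algHom.toRingHom
  { carrier := M
    isTower := ⟨fun c a v => by
      change hT.algHom (c • a) v = c • hT.algHom a v
      simp⟩ }

theorem IsHeckeBRep.not_hasFiniteRepresentationType {e f : ℕ} (hf : f < e) (hn : e ≤ n)
    (H : ∀ d : ℕ, ∃ (M : Type) (_ : AddCommGroup M) (_ : Module K M) (_ : FiniteDimensional K M)
      (T : ℕ → Module.End K M), IsHeckeBRep α β q n T ∧
        ¬ relationChain q e f T (d + 1) ≤ relationChain q e f T d) :
    ¬ HasFiniteRepresentationType K (HeckeB K α β q n) := by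
  intro h
  obtain ⟨d, hd⟩ := h.exists_finrank_le
  obtain ⟨M, _, _, _, T, hT, hchain⟩ := H d
  refine hchain fun v hv => ?_
  have comm : ∀ k < e, ∀ v : M, hT.toFDRightModule.operators (heckeBGenerator α β q n) k v =
      T k v := by
    intro k hk v
    rw [← hT.algHom_generator (hk.trans_le hn)]
    rfl
  have h₁ := map_mem_relationChain
    (T' := hT.toFDRightModule.operators (heckeBGenerator α β q n))
    (φ := (LinearMap.id : M →ₗ[K] M)) q hf (fun k hk v => (comm k hk v).symm) hv
  exact map_mem_relationChain (φ := (LinearMap.id : M →ₗ[K] M)) q hf comm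
    (FDRightModule.relationChain_succ_le hd (heckeBGenerator α β q n) q hf
      hT.toFDRightModule h₁)

end toModule

end HeckeRepresentations

section Induction

variable {K M : Type*} [Field K] [AddCommGroup M] [Module K M] {α β q : K} {n : ℕ}
  {T : ℕ → Module.End K M}

/-- The operators induced by `T` on families of vectors indexed by the position and the sign
of a new letter in a signed word. -/
def inducedOperator (α β q : K) (T : ℕ → Module.End K M) :
    ℕ → Module.End K (ℕ → Bool → M)
  | 0 =>
    { toFun := fun g p σ =>
        if p = 0 then cond σ (-(α * β) • g 0 false) (g 0 true + (α + β) • g 0 false)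
        else T 0 (g p σ)
      map_add' := fun g h => by
        funext p σ
        cases σ <;> dsimp <;> split_ifs <;> first | exact map_add _ _ _ | module
      map_smul' := fun c g => by
        funext p σ
        cases σ <;> dsimp <;> split_ifs <;> first | exact map_smul _ _ _ | module }
  | j + 1 =>
    { toFun := fun g p σ =>
        if p = j + 1 then
          cond σ (q • g j true) (g j false + (q - 1) • g (j + 1) false)
        else if p = j then
          cond σ (g (j + 1) true + (q - 1) • g j true) (q • g (j + 1) false)
        else if p < j then T j (g p σ) else T (j + 1) (g p σ)
      map_add' := fun g h => by
        funext p σ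
        cases σ <;> dsimp <;> split_ifs <;> first | exact map_add _ _ _ | module
      map_smul' := fun c g => by
        funext p σ
        cases σ <;> dsimp <;> split_ifs <;> first | exact map_smul _ _ _ | module }

variable (g : ℕ → Bool → M) (j : ℕ) {p : ℕ} (σ : Bool)

theorem inducedOperator_zero_true :
    inducedOperator α β q T 0 g 0 true = -(α * β) • g 0 false := rfl

theorem inducedOperator_zero_false :
    inducedOperator α β q T 0 g 0 false = g 0 true + (α + β) • g 0 false := rfl

theorem inducedOperator_succ_true :
    inducedOperator α β q T (j + 1) g (j + 1) true = q • g j true := by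
  simp [inducedOperator]

theorem inducedOperator_succ_false :
    inducedOperator α β q T (j + 1) g (j + 1) false = g j false + (q - 1) • g (j + 1) false := by
  simp [inducedOperator]

theorem inducedOperator_self_true :
    inducedOperator α β q T (j + 1) g j true = g (j + 1) true + (q - 1) • g j true := by
  simp [inducedOperator]

theorem inducedOperator_self_false :
    inducedOperator α β q T (j + 1) g j false = q • g (j + 1) false := by
  simp [inducedOperator]

theorem inducedOperator_of_lt (hp : p < j) :
    inducedOperator α β q T (j + 1) g p σ = T j (g p σ) := by
  simp [inducedOperator, hp, hp.ne, (show p ≠ j + 1 by omega)]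

theorem inducedOperator_of_gt (hp : j < p) :
    inducedOperator α β q T j g p σ = T j (g p σ) := by
  cases j with
  | zero => simp [inducedOperator, hp.ne']
  | succ j =>
    simp [inducedOperator, hp.ne', (show p ≠ j by omega), (show ¬ p < j by omega)]

variable {j}

theorem inducedOperator_quad_zero (hT : IsHeckeBRep α β q n T) (hp : p ≤ n) :
    inducedOperator α β q T 0 (inducedOperator α β q T 0 g) p σ =
      (α + β) • inducedOperator α β q T 0 g p σ - (α * β) • g p σ := by
  rcases p.eq_zero_or_pos with rfl | h
  · cases σ <;> simp only [inducedOperator_zero_true, inducedOperator_zero_false] <;> module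
  · simp (disch := omega) only [inducedOperator_of_gt, hT.quad_zero]

theorem inducedOperator_quad (hT : IsHeckeBRep α β q n T) (hp : p ≤ n) (hj : j < n) :
    inducedOperator α β q T (j + 1) (inducedOperator α β q T (j + 1) g) p σ =
      (q - 1) • inducedOperator α β q T (j + 1) g p σ + q • g p σ := by
  rcases (by omega : p < j ∨ p = j ∨ p = j + 1 ∨ j + 1 < p) with h | rfl | rfl | h
  · simp (disch := omega) only [inducedOperator_of_lt, hT.quad]
  · cases σ <;> simp only [inducedOperator_succ_true, inducedOperator_succ_false,
      inducedOperator_self_true, inducedOperator_self_false] <;> module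
  · cases σ <;> simp only [inducedOperator_succ_true, inducedOperator_succ_false,
      inducedOperator_self_true, inducedOperator_self_false] <;> module
  · simp (disch := omega) only [inducedOperator_of_gt, hT.quad]

theorem inducedOperator_braid_zero (hT : IsHeckeBRep α β q n T) (hp : p ≤ n) (hn : 0 < n) :
    inducedOperator α β q T 0 (inducedOperator α β q T 1 (inducedOperator α β q T 0
      (inducedOperator α β q T 1 g))) p σ =
    inducedOperator α β q T 1 (inducedOperator α β q T 0 (inducedOperator α β q T 1
      (inducedOperator α β q T 0 g))) p σ := by
  have e₁ := fun g : ℕ → Bool → M =>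
    inducedOperator_succ_true (α := α) (β := β) (q := q) (T := T) g 0
  have e₂ := fun g : ℕ → Bool → M =>
    inducedOperator_succ_false (α := α) (β := β) (q := q) (T := T) g 0
  have e₃ := fun g : ℕ → Bool → M =>
    inducedOperator_self_true (α := α) (β := β) (q := q) (T := T) g 0
  have e₄ := fun g : ℕ → Bool → M =>
    inducedOperator_self_false (α := α) (β := β) (q := q) (T := T) g 0
  simp only [zero_add] at e₁ e₂ e₃ e₄
  rcases (by omega : p = 0 ∨ p = 1 ∨ 1 < p) with rfl | rfl | h
  · cases σ <;> simp (disch := omega) only [e₁, e₂, e₃, e₄, inducedOperator_zero_true,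
      inducedOperator_zero_false, inducedOperator_of_gt, map_add, map_smul, hT.quad_zero] <;>
      module
  · cases σ <;> simp (disch := omega) only [e₁, e₂, e₃, e₄, inducedOperator_zero_true,
      inducedOperator_zero_false, inducedOperator_of_gt, map_add, map_smul, hT.quad_zero]
    module
  · simp (disch := omega) only [inducedOperator_of_gt, hT.braid_zero]

theorem inducedOperator_braid (hT : IsHeckeBRep α β q n T) (hp : p ≤ n) (hj : j + 1 < n) :
    inducedOperator α β q T (j + 1 + 1) (inducedOperator α β q T (j + 1)
      (inducedOperator α β q T (j + 1 + 1) g)) p σ =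
    inducedOperator α β q T (j + 1) (inducedOperator α β q T (j + 1 + 1)
      (inducedOperator α β q T (j + 1) g)) p σ := by
  rcases (by omega : p < j ∨ p = j ∨ p = j + 1 ∨ p = j + 1 + 1 ∨ j + 1 + 1 < p) with
    h | rfl | rfl | rfl | h
  · simp (disch := omega) only [inducedOperator_of_lt, hT.braid]
  · cases σ <;> simp (disch := omega) only [inducedOperator_succ_true, inducedOperator_self_true,
      inducedOperator_self_false, inducedOperator_of_lt, inducedOperator_of_gt, map_add, map_smul,
      hT.quad]
    module
  · cases σ <;> simp (disch := omega) only [inducedOperator_succ_true, inducedOperator_succ_false,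
      inducedOperator_self_true, inducedOperator_self_false, inducedOperator_of_lt,
      inducedOperator_of_gt, map_add, map_smul] <;> module
  · cases σ <;> simp (disch := omega) only [inducedOperator_succ_true, inducedOperator_succ_false,
      inducedOperator_self_false, inducedOperator_of_lt, inducedOperator_of_gt, map_add, map_smul,
      hT.quad]
    module
  · simp (disch := omega) only [inducedOperator_of_gt, hT.braid]

theorem inducedOperator_comm (hT : IsHeckeBRep α β q n T) (hp : p ≤ n) {i : ℕ} (hij : i < j)
    (hj : j < n) :
    inducedOperator α β q T i (inducedOperator α β q T (j + 1) g) p σ =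
      inducedOperator α β q T (j + 1) (inducedOperator α β q T i g) p σ := by
  have h₁ : p ≤ i ∨ (i < p ∧ p < j) ∨ p = j ∨ p = j + 1 ∨ j + 1 < p := by omega
  rcases h₁ with h | ⟨h, h'⟩ | rfl | rfl | h
  · cases i with
    | zero =>
      obtain rfl : p = 0 := by omega
      cases σ <;> simp (disch := omega) only [inducedOperator_zero_true,
        inducedOperator_zero_false, inducedOperator_of_lt, map_add, map_smul]
    | succ i =>
      rcases (by omega : p < i ∨ p = i ∨ p = i + 1) with h | rfl | rfl
      · simp (disch := omega) only [inducedOperator_of_lt, hT.comm]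
      · cases σ <;> simp (disch := omega) only [inducedOperator_self_true,
          inducedOperator_self_false, inducedOperator_of_lt, map_add, map_smul]
      · cases σ <;> simp (disch := omega) only [inducedOperator_succ_true,
          inducedOperator_succ_false, inducedOperator_of_lt, map_add, map_smul]
  · simp (disch := omega) only [inducedOperator_of_lt, inducedOperator_of_gt, hT.comm]
  · cases σ <;> simp (disch := omega) only [inducedOperator_self_true,
      inducedOperator_self_false, inducedOperator_of_gt, map_add, map_smul]
  · cases σ <;> simp (disch := omega) only [inducedOperator_succ_true,
      inducedOperator_succ_false, inducedOperator_of_gt, map_add, map_smul]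
  · simp (disch := omega) only [inducedOperator_of_gt]
    exact hT.comm i (j + 1) (by omega) (by omega) _

variable (M n) in
/-- Families of vectors supported in positions at most `n`. -/
def boundedFamilies : Submodule K (ℕ → Bool → M) where
  carrier := {g | ∀ p, n < p → g p = 0}
  zero_mem' := fun _ _ => rfl
  add_mem' := fun hg hh p hp => by simp [hg p hp, hh p hp]
  smul_mem' := fun c g hg p hp => by simp [hg p hp]

theorem inducedOperator_mem {g : ℕ → Bool → M} (hg : g ∈ boundedFamilies (K := K) M n)
    (hj : j ≤ n) :
    inducedOperator α β q T j g ∈ boundedFamilies (K := K) M n := by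
  intro p hp
  funext σ
  simp [inducedOperator_of_gt g j σ (hj.trans_lt hp), hg p hp]

instance [FiniteDimensional K M] : FiniteDimensional K (boundedFamilies (K := K) M n) := by
  let ψ : boundedFamilies (K := K) M n →ₗ[K] (Fin (n + 1) → Bool → M) :=
    { toFun := fun g p => g.1 p
      map_add' := fun _ _ => rfl
      map_smul' := fun _ _ => rfl }
  refine FiniteDimensional.of_injective ψ fun g h hgh => ?_
  ext1
  funext p
  by_cases hp : n < p
  · rw [g.2 p hp, h.2 p hp]
  · exact congrFun hgh ⟨p, by omega⟩

/-- The induced operators on bounded families. -/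
def inducedRep (α β q : K) (n : ℕ) (T : ℕ → Module.End K M) (j : ℕ) :
    Module.End K (boundedFamilies (K := K) M n) :=
  if h : j ≤ n then (inducedOperator α β q T j).restrict fun _ hg => inducedOperator_mem hg h
  else 0

theorem inducedRep_apply (h : j ≤ n) (g : boundedFamilies (K := K) M n) :
    (inducedRep α β q n T j g : ℕ → Bool → M) = inducedOperator α β q T j g := by
  rw [inducedRep, dif_pos h]
  rfl

theorem boundedFamilies_ext {g h : boundedFamilies (K := K) M n}
    (hgh : ∀ p ≤ n, ∀ σ, (g : ℕ → Bool → M) p σ = (h : ℕ → Bool → M) p σ) : g = h := by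
  ext1
  funext p
  by_cases hp : p ≤ n
  · exact funext (hgh p hp)
  · rw [g.2 p (by omega), h.2 p (by omega)]

theorem IsHeckeBRep.inducedRep (hT : IsHeckeBRep α β q n T) :
    IsHeckeBRep α β q (n + 1) (inducedRep α β q n T) where
  quad_zero _ g := boundedFamilies_ext fun p hp σ => by
    simpa [inducedRep_apply] using inducedOperator_quad_zero g.1 σ hT hp
  quad i hi hin g := boundedFamilies_ext fun p hp σ => by
    obtain ⟨j, rfl⟩ := Nat.exists_eq_succ_of_ne_zero hi.ne'
    simpa (disch := omega) [inducedRep_apply] using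
      inducedOperator_quad g.1 σ hT hp (by omega : j < n)
  braid_zero hn g := boundedFamilies_ext fun p hp σ => by
    simpa (disch := omega) [inducedRep_apply] using
      inducedOperator_braid_zero g.1 σ hT hp (by omega)
  braid i hi hin g := boundedFamilies_ext fun p hp σ => by
    obtain ⟨j, rfl⟩ := Nat.exists_eq_succ_of_ne_zero hi.ne'
    simpa (disch := omega) [inducedRep_apply] using
      inducedOperator_braid g.1 σ hT hp (by omega : j + 1 < n)
  comm i j hij hj g := boundedFamilies_ext fun p hp σ => by
    obtain ⟨j, rfl⟩ := Nat.exists_eq_succ_of_ne_zero (by omega : j ≠ 0)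
    simpa (disch := omega) [inducedRep_apply] using
      inducedOperator_comm g.1 σ hT hp (by omega : i < j) (by omega)

/-- The embedding of a representation in the induced one. -/
def inducedRepInclusion (K M : Type*) [Field K] [AddCommGroup M] [Module K M] (n : ℕ) :
    M →ₗ[K] boundedFamilies (K := K) M n where
  toFun m := ⟨fun p σ => if p = n ∧ σ then m else 0, fun p hp => by
    funext σ
    simp [hp.ne']⟩
  map_add' _ _ := boundedFamilies_ext fun p _ σ => by simp; split_ifs <;> simp
  map_smul' _ _ := boundedFamilies_ext fun p _ σ => by simp

theorem inducedRepInclusion_apply {k : ℕ} (hk : k < n) (m : M) :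
    inducedRepInclusion K M n (T k m) =
      inducedRep α β q n T k (inducedRepInclusion K M n m) := by
  apply boundedFamilies_ext
  intro p hp σ
  rw [inducedRep_apply hk.le]
  rcases hp.eq_or_lt with rfl | h
  · rw [inducedOperator_of_gt _ _ _ hk]
    cases σ <;> simp [inducedRepInclusion]
  · rcases k with _ | k
    · rcases p.eq_zero_or_pos with rfl | h'
      · cases σ <;> simp [inducedOperator_zero_true, inducedOperator_zero_false,
          inducedRepInclusion, hk.ne]
      · simp [inducedOperator_of_gt _ _ _ h', inducedRepInclusion, h.ne]
    · rcases (by omega : p < k ∨ p = k ∨ p = k + 1 ∨ k + 1 < p) with h' | rfl | rfl | h'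
      · simp [inducedOperator_of_lt _ _ _ h', inducedRepInclusion, h.ne]
      · cases σ <;> simp [inducedOperator_self_true, inducedOperator_self_false,
          inducedRepInclusion, h.ne, hk.ne]
      · cases σ <;> simp [inducedOperator_succ_true, inducedOperator_succ_false,
          inducedRepInclusion, h.ne, (show k ≠ n by omega)]
      · simp [inducedOperator_of_gt _ _ _ h', inducedRepInclusion, h.ne]

theorem relationChain_inducedRep {e f d : ℕ} (hf : f < e) (hn : e ≤ n)
    (h : relationChain q e f (inducedRep α β q n T) (d + 1) ≤
      relationChain q e f (inducedRep α β q n T) d) :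
    relationChain q e f T (d + 1) ≤ relationChain q e f T d := by
  intro v hv
  let π : boundedFamilies (K := K) M n →ₗ[K] M :=
    { toFun := fun g => g.1 n true
      map_add' := fun _ _ => rfl
      map_smul' := fun _ _ => rfl }
  have h₁ : ∀ k < e, ∀ g, π (inducedRep α β q n T k g) = T k (π g) := by
    intro k hk g
    change (inducedRep α β q n T k g).1 n true = _
    rw [inducedRep_apply (by omega), inducedOperator_of_gt _ _ _ (by omega)]
    rfl
  have h₂ := map_mem_relationChain q hf h₁ (h (map_mem_relationChain q hf
    (fun k hk m => inducedRepInclusion_apply (α := α) (β := β) (q := q) (hk.trans_le hn) m) hv))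
  simpa [π, inducedRepInclusion] using h₂

end Induction

section Words

variable {K C ι : Type*} [Field K] [CommRing C] [Algebra K C]

/-- The operator exchanging the letters in positions `a` and `b` of a word, in seminormal form:
its diagonal and off-diagonal coefficients depend on the two letters through `c` and `D`. -/
def wordOperator (K : Type*) [Field K] [Algebra K C] [DecidableEq ι] (c D : ι → ι → C) (a b : ι) :
    Module.End K (Equiv.Perm ι → C) where
  toFun g w := c (w a) (w b) * g w + D (w a) (w b) * g (w * Equiv.swap a b)
  map_add' g h := by funext w; simp; ring
  map_smul' r g := by funext w; simp

/-- Multiplication by the value of `ξ` at the letter in position `a`. -/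
def letterOperator (K : Type*) [Field K] [Algebra K C] (ξ : ι → C) (a : ι) :
    Module.End K (Equiv.Perm ι → C) where
  toFun g w := ξ (w a) * g w
  map_add' g h := by funext w; simp; ring
  map_smul' r g := by funext w; simp

theorem wordOperator_apply [DecidableEq ι] (c D : ι → ι → C) (a b : ι) (g : Equiv.Perm ι → C)
    (w : Equiv.Perm ι) : wordOperator K c D a b g w =
      c (w a) (w b) * g w + D (w a) (w b) * g (w * Equiv.swap a b) := rfl

theorem letterOperator_apply (ξ : ι → C) (a : ι) (g : Equiv.Perm ι → C) (w : Equiv.Perm ι) :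
    letterOperator K ξ a g w = ξ (w a) * g w := rfl

/-- Coefficients `c`, `D` defining operators with the quadratic and braid relations. -/
structure IsSeminormal (q : K) (ξ : ι → C) (c D : ι → ι → C) : Prop where
  add_swap : ∀ r s, r ≠ s → c r s + c s r = algebraMap K C q - 1
  mul_swap : ∀ r s, r ≠ s → D r s * D s r = algebraMap K C q + c r s * c s r
  triple : ∀ r s t, r ≠ s → s ≠ t → r ≠ t → c r s * c s t + c r t * c s r = c s t * c r t
  letter : ∀ r s, r ≠ s → c r s * ξ r + c s r * ξ s = 0

variable [DecidableEq ι] {q : K} {ξ : ι → C} {c D : ι → ι → C}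

theorem IsSeminormal.quad (h : IsSeminormal q ξ c D) {a b : ι} (hab : a ≠ b)
    (g : Equiv.Perm ι → C) :
    wordOperator K c D a b (wordOperator K c D a b g) =
      (q - 1) • wordOperator K c D a b g + q • g := by
  funext w
  have hw : w a ≠ w b := w.injective.ne hab
  have h₁ := h.add_swap _ _ hw
  have h₂ := h.mul_swap _ _ hw
  simp only [wordOperator_apply, Pi.add_apply, Pi.smul_apply, Algebra.smul_def (A := C),
    map_sub, map_one,
    Equiv.Perm.mul_apply, Equiv.swap_apply_left, Equiv.swap_apply_right, mul_assoc,
    Equiv.swap_mul_self, mul_one]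
  linear_combination (g w * c (w a) (w b) + D (w a) (w b) * g (w * Equiv.swap a b)) * h₁ + g w * h₂

theorem IsSeminormal.mul_letter_mul (h : IsSeminormal q ξ c D) {a b : ι} (hab : a ≠ b)
    (g : Equiv.Perm ι → C) :
    wordOperator K c D a b (letterOperator K ξ a (wordOperator K c D a b g)) =
      q • letterOperator K ξ b g := by
  funext w
  have hw : w a ≠ w b := w.injective.ne hab
  have h₁ := h.letter _ _ hw
  have h₂ := h.mul_swap _ _ hw
  simp only [wordOperator_apply, letterOperator_apply, Pi.smul_apply, Algebra.smul_def (A := C),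
    Equiv.Perm.mul_apply, Equiv.swap_apply_left, Equiv.swap_apply_right, mul_assoc,
    Equiv.swap_mul_self, mul_one]
  linear_combination (g w * c (w a) (w b) + D (w a) (w b) * g (w * Equiv.swap a b)) * h₁ +
    g w * ξ (w b) * h₂

theorem IsSeminormal.braid (h : IsSeminormal q ξ c D) {a b d : ι} (hab : a ≠ b)
    (hbd : b ≠ d) (had : a ≠ d) (g : Equiv.Perm ι → C) :
    wordOperator K c D b d (wordOperator K c D a b (wordOperator K c D b d g)) =
      wordOperator K c D a b (wordOperator K c D b d (wordOperator K c D a b g)) := by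
  funext w
  have hw : w a ≠ w b := w.injective.ne hab
  have hw' : w b ≠ w d := w.injective.ne hbd
  have hw'' : w a ≠ w d := w.injective.ne had
  have h₀ : Equiv.swap b d * (Equiv.swap a b * Equiv.swap b d) =
      Equiv.swap a b * (Equiv.swap b d * Equiv.swap a b) := by
    have h₁ := Equiv.swap_mul_swap_mul_swap hab had
    have h₂ := Equiv.swap_mul_swap_mul_swap hbd.symm had.symm
    rw [← mul_assoc, h₁, ← mul_assoc, Equiv.swap_comm a b, Equiv.swap_comm b d, h₂,
      Equiv.swap_comm]
  simp only [wordOperator_apply, Equiv.Perm.mul_apply, Equiv.swap_apply_left,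
    Equiv.swap_apply_right, mul_assoc, Equiv.swap_mul_self, mul_one, h₀,
    Equiv.swap_apply_of_ne_of_ne hab had, Equiv.swap_apply_of_ne_of_ne had.symm hbd.symm]
  generalize w a = r, w b = s, w d = t at *
  have h₁ := h.triple r s t hw hw' hw''
  have h₂ := h.add_swap s t hw'
  have h₃ := h.add_swap r s hw
  have h₄ := h.mul_swap s t hw'
  have h₅ := h.mul_swap r s hw
  linear_combination
    g w * (c r t * (h₄ - h₅) + (c s t - c r s) * h₁ + c r t * c s t * (h₂ - h₃)) -
    g (w * Equiv.swap a b) * D r s * h₁ +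
    g (w * Equiv.swap b d) * D s t * (h₁ + c r t * (h₂ - h₃))

theorem wordOperator_comm {a b a' b' : ι} (h₁ : a ≠ a') (h₂ : a ≠ b') (h₃ : b ≠ a') (h₄ : b ≠ b')
    (g : Equiv.Perm ι → C) :
    wordOperator K c D a b (wordOperator K c D a' b' g) =
      wordOperator K c D a' b' (wordOperator K c D a b g) := by
  funext w
  have h₀ : Equiv.swap a b * Equiv.swap a' b' = Equiv.swap a' b' * Equiv.swap a b := by
    ext x
    simp only [Equiv.Perm.mul_apply, Equiv.swap_apply_def]
    grind
  simp only [wordOperator_apply, Equiv.Perm.mul_apply, mul_assoc, h₀,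
    Equiv.swap_apply_of_ne_of_ne h₁ h₂, Equiv.swap_apply_of_ne_of_ne h₃ h₄,
    Equiv.swap_apply_of_ne_of_ne h₁.symm h₃.symm, Equiv.swap_apply_of_ne_of_ne h₂.symm h₄.symm]
  ring

theorem letterOperator_comm_wordOperator {a b d : ι} (h₁ : d ≠ a) (h₂ : d ≠ b)
    (g : Equiv.Perm ι → C) :
    letterOperator K ξ d (wordOperator K c D a b g) =
      wordOperator K c D a b (letterOperator K ξ d g) := by
  funext w
  simp only [wordOperator_apply, letterOperator_apply, Equiv.Perm.mul_apply,
    Equiv.swap_apply_of_ne_of_ne h₁ h₂]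
  ring

end Words

section WordRep

variable {K C : Type*} [Field K] [CommRing C] [Algebra K C] {e : ℕ} {α β q : K} {ξ : Fin e → C}
  {c D : Fin e → Fin e → C}

/-- The operators on functions on the set of words in seminormal form, where `T₀` acts through
the first letter. -/
def wordRep (K : Type*) [Field K] [Algebra K C] (ξ : Fin e → C) (c D : Fin e → Fin e → C) :
    ℕ → Module.End K (Equiv.Perm (Fin e) → C)
  | 0 => if h : 0 < e then letterOperator K ξ ⟨0, h⟩ else 0
  | k + 1 => if h : k + 1 < e then wordOperator K c D ⟨k, by omega⟩ ⟨k + 1, h⟩ else 0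

theorem wordRep_zero (h : 0 < e) : wordRep K ξ c D 0 = letterOperator K ξ ⟨0, h⟩ := dif_pos h

theorem wordRep_succ {k : ℕ} (h : k + 1 < e) :
    wordRep K ξ c D (k + 1) = wordOperator K c D ⟨k, by omega⟩ ⟨k + 1, h⟩ := dif_pos h

theorem IsSeminormal.jucysMurphy_wordRep (h : IsSeminormal q ξ c D) (hq : q ≠ 0) {k : ℕ}
    (hk : k < e) : jucysMurphy q (wordRep K ξ c D) k = letterOperator K ξ ⟨k, hk⟩ := by
  induction k with
  | zero => exact wordRep_zero hk
  | succ k ih =>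
    refine LinearMap.ext fun g => ?_
    have := h.mul_letter_mul (a := ⟨k, by omega⟩) (b := ⟨k + 1, hk⟩) (by simp) g
    rw [jucysMurphy, ih (by omega), wordRep_succ hk, LinearMap.smul_apply, Module.End.mul_apply,
      Module.End.mul_apply, this, inv_smul_smul₀ hq]

theorem IsSeminormal.isHeckeBRep (h : IsSeminormal q ξ c D)
    (L : Submodule K (Equiv.Perm (Fin e) → C)) (hL : ∀ k, ∀ g ∈ L, wordRep K ξ c D k g ∈ L)
    (hquad : ∀ he : 0 < e, ∀ g ∈ L, ∀ w, (ξ (w ⟨0, he⟩) - algebraMap K C α) *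
      (ξ (w ⟨0, he⟩) - algebraMap K C β) * g w = 0) :
    IsHeckeBRep α β q e fun k => (wordRep K ξ c D k).restrict (hL k) where
  quad_zero he g := by
    ext w
    have := hquad he g g.2 w
    simp only [wordRep_zero he, LinearMap.restrict_apply, letterOperator_apply,
      Submodule.coe_sub, Submodule.coe_smul, Pi.sub_apply, Pi.smul_apply,
      Algebra.smul_def (A := C), map_add, map_mul]
    linear_combination this
  quad i hi hie g := by
    obtain ⟨k, rfl⟩ := Nat.exists_eq_succ_of_ne_zero hi.ne'
    ext1
    simpa [LinearMap.restrict_apply, wordRep_succ hie] using h.quad (by simp) g.1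
  braid_zero he g := by
    ext1
    have h₁ := h.mul_letter_mul (a := ⟨0, by omega⟩) (b := ⟨0 + 1, he⟩) (by simp)
    have h₂ : wordRep K ξ c D 1 = wordOperator K c D ⟨0, by omega⟩ ⟨0 + 1, he⟩ :=
      wordRep_succ he
    simp only [LinearMap.restrict_apply, wordRep_zero (by omega : 0 < e), h₂, h₁, map_smul]
    congr 1
    ext w
    simp only [letterOperator_apply]
    ring
  braid i hi hie g := by
    obtain ⟨k, rfl⟩ := Nat.exists_eq_succ_of_ne_zero hi.ne'
    ext1
    simpa [LinearMap.restrict_apply, wordRep_succ hie, wordRep_succ (by omega : k + 1 < e)] using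
      h.braid (by simp) (by simp) (by simp; omega) g.1
  comm i j hij hj g := by
    obtain ⟨k, rfl⟩ := Nat.exists_eq_succ_of_ne_zero (by omega : j ≠ 0)
    ext1
    rcases i with _ | i
    · simp only [LinearMap.restrict_apply, wordRep_zero (by omega : 0 < e), wordRep_succ hj]
      exact letterOperator_comm_wordOperator (by simp; omega) (by simp) _
    · simp only [LinearMap.restrict_apply, wordRep_succ (by omega : i + 1 < e), wordRep_succ hj]
      exact wordOperator_comm (by simp; omega) (by simp; omega) (by simp; omega)
        (by simp; omega) _

end WordRep

section Coefficients

variable {K C ι : Type*} [Field K] [CommRing C] [Algebra K C] [LinearOrder ι]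

/-- The diagonal coefficients of the seminormal form attached to the weights `ξ`. -/
noncomputable def diagonalCoeff (q : K) (ξ : ι → C) (r s : ι) : C :=
  (algebraMap K C q - 1) * ξ s * Ring.inverse (ξ s - ξ r)

/-- The off-diagonal coefficients of the seminormal form attached to the weights `ξ`. -/
noncomputable def offDiagonalCoeff (q : K) (ξ : ι → C) (r s : ι) : C :=
  if r < s then 1 else
    (ξ s - algebraMap K C q * ξ r) * (algebraMap K C q * ξ s - ξ r) * Ring.inverse (ξ s - ξ r) ^ 2

theorem isSeminormal_coeff (q : K) {ξ : ι → C} (hξ : ∀ r s, r ≠ s → IsUnit (ξ s - ξ r)) :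
    IsSeminormal q ξ (diagonalCoeff q ξ) (offDiagonalCoeff q ξ) := by
  have hu : ∀ r s, r ≠ s → (ξ s - ξ r) * Ring.inverse (ξ s - ξ r) = 1 := fun r s h =>
    Ring.mul_inverse_cancel _ (hξ r s h)
  have hneg : ∀ r s, Ring.inverse (ξ r - ξ s) = -Ring.inverse (ξ s - ξ r) := fun r s => by
    have h : Ring.inverse (-1 : C) = -1 := by simpa using Ring.inverse_unit (-1 : Cˣ)
    rw [← neg_sub, neg_eq_neg_one_mul, Ring.inverse_mul (Or.inl isUnit_one.neg), h, mul_neg_one]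
  refine ⟨fun r s h => ?_, fun r s h => ?_, fun r s t h₁ h₂ h₃ => ?_, fun r s h => ?_⟩
  · simp only [diagonalCoeff, hneg r s]
    linear_combination (algebraMap K C q - 1) * hu r s h
  · have key : (ξ s - algebraMap K C q * ξ r) * (algebraMap K C q * ξ s - ξ r) *
        Ring.inverse (ξ s - ξ r) ^ 2 = algebraMap K C q + (diagonalCoeff q ξ r s) *
          (diagonalCoeff q ξ s r) := by
      simp only [diagonalCoeff, hneg r s]
      linear_combination algebraMap K C q *
        ((ξ s - ξ r) * Ring.inverse (ξ s - ξ r) + 1) * hu r s h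
    rw [← key]
    rcases lt_or_gt_of_ne h with h | h
    · simp only [offDiagonalCoeff, h, h.not_gt, if_true, if_false, hneg r s]
      ring
    · simp only [offDiagonalCoeff, h, h.not_gt, if_true, if_false]
      ring
  · simp only [diagonalCoeff, hneg r s]
    linear_combination (algebraMap K C q - 1) ^ 2 * ξ t *
      (-(ξ s * Ring.inverse (ξ s - ξ r) * Ring.inverse (ξ t - ξ s)) * hu r t h₃ +
      ξ r * Ring.inverse (ξ s - ξ r) * Ring.inverse (ξ t - ξ r) * hu s t h₂ +
      ξ t * Ring.inverse (ξ t - ξ r) * Ring.inverse (ξ t - ξ s) * hu r s h₁)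
  · simp only [diagonalCoeff, hneg r s]
    ring

end Coefficients

section BaseCase

open TrivSqZeroExt

variable {K R : Type*} [Field K] [CommRing R] [Algebra K R] {q : K} {e f : ℕ} {t : R}

theorem mul_eq_zero_of_fst_eq_zero {x y : DualNumber R} (hx : x.fst = 0) (hy : y.fst = 0) :
    x * y = 0 := by
  ext <;> simp [hx, hy]

/-- The infinitesimal parts of the weights. -/
def weightSlope (e f : ℕ) (t : R) (r : ℕ) : R :=
  if r < f then 0 else if r + 1 < e then 1 else t

/-- The deformation `q ^ r * (1 + a r * ε)` of the weight `q ^ r`. -/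
def deformedWeight (q : K) (f : ℕ) (t : R) (r : Fin e) : DualNumber R :=
  inl (algebraMap K R (q ^ (r : ℕ))) + inr (algebraMap K R (q ^ (r : ℕ)) * weightSlope e f t r)

theorem fst_deformedWeight (r : Fin e) :
    (deformedWeight q f t r).fst = algebraMap K R (q ^ (r : ℕ)) := by
  simp [deformedWeight]

theorem snd_deformedWeight (r : Fin e) : (deformedWeight q f t r).snd =
    algebraMap K R (q ^ (r : ℕ)) * weightSlope e f t r := by
  simp [deformedWeight]

theorem fst_algebraMap_dualNumber (x : K) :
    (algebraMap K (DualNumber R) x).fst = algebraMap K R x := rfl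

theorem snd_algebraMap_dualNumber (x : K) : (algebraMap K (DualNumber R) x).snd = 0 := rfl

theorem isUnit_deformedWeight_sub (hq : IsPrimitiveRoot q e) {r : Fin e} {s : ℕ} (hs : s < e)
    (h : (r : ℕ) ≠ s) :
    IsUnit (deformedWeight q f t r - algebraMap K (DualNumber R) (q ^ s)) := by
  rw [isUnit_iff_isUnit_fst, fst_sub, fst_deformedWeight, fst_algebraMap_dualNumber, ← map_sub]
  exact (IsUnit.mk0 _ (sub_ne_zero.mpr fun h' => h (hq.pow_inj r.2 hs h'))).map _

theorem isUnit_deformedWeight_sub_deformedWeight (hq : IsPrimitiveRoot q e) (r s : Fin e)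
    (h : r ≠ s) : IsUnit (deformedWeight q f t s - deformedWeight q f t r) := by
  have := isUnit_deformedWeight_sub (R := R) (f := f) (t := t) hq (r := s) r.2
    (fun h' => h (Fin.ext h'.symm))
  rw [isUnit_iff_isUnit_fst] at this ⊢
  simpa [fst_deformedWeight, fst_algebraMap_dualNumber] using this

/-- The pairs of letters which are required to appear in increasing order. -/
def IsOrderedPair (f : ℕ) (r s : Fin e) : Prop :=
  ((r : ℕ) = 0 ∧ (s : ℕ) + 1 = e) ∨ ((s : ℕ) = r + 1 ∧ (s : ℕ) ≠ f ∧ (s : ℕ) + 1 ≠ e)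

theorem IsOrderedPair.lt (he : 3 ≤ e) {r s : Fin e} (h : IsOrderedPair f r s) : r < s := by
  rw [Fin.lt_def]
  unfold IsOrderedPair at h
  omega

/-- The words in which all ordered pairs appear in increasing order. -/
def IsOrderedWord (f : ℕ) (w : Equiv.Perm (Fin e)) : Prop :=
  ∀ r s, IsOrderedPair f r s → w⁻¹ r < w⁻¹ s

theorem isOrderedWord_one (he : 3 ≤ e) : IsOrderedWord f (1 : Equiv.Perm (Fin e)) :=
  fun _ _ h => h.lt he

theorem IsOrderedWord.apply_zero (he : 3 ≤ e) {w : Equiv.Perm (Fin e)} (hw : IsOrderedWord f w) :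
    (w ⟨0, by omega⟩ : ℕ) = 0 ∨ (w ⟨0, by omega⟩ : ℕ) = f := by
  by_contra! h
  have key : ∀ r, ¬ IsOrderedPair f r (w ⟨0, by omega⟩) := by
    intro r hr
    have := hw _ _ hr
    simp [Fin.lt_def] at this
  by_cases h' : (w ⟨0, by omega⟩ : ℕ) + 1 = e
  · exact key ⟨0, by omega⟩ (Or.inl ⟨rfl, h'⟩)
  · refine key ⟨(w ⟨0, by omega⟩ : ℕ) - 1, by omega⟩ (Or.inr ⟨?_, h.2, h'⟩)
    change _ = _ - 1 + 1
    omega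

/-- The functions vanishing on the words which are not ordered, and infinitesimal on all words
but the identity. -/
def orderedFunctions (K R : Type*) [Field K] [CommRing R] [Algebra K R] (e f : ℕ) :
    Submodule K (Equiv.Perm (Fin e) → DualNumber R) where
  carrier := {g | ∀ w, (w ≠ 1 → (g w).fst = 0) ∧ (¬ IsOrderedWord f w → g w = 0)}
  zero_mem' := by simp
  add_mem' hg hh w :=
    ⟨fun hw => by simp [(hg w).1 hw, (hh w).1 hw], fun hw => by simp [(hg w).2 hw, (hh w).2 hw]⟩
  smul_mem' c g hg w := ⟨fun hw => by simp [(hg w).1 hw], fun hw => by simp [(hg w).2 hw]⟩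

theorem fst_offDiagonalCoeff_of_succ {r s : Fin e} (h : (s : ℕ) = r + 1) :
    (offDiagonalCoeff q (deformedWeight q f t) s r).fst = 0 := by
  have : ¬ s < r := by rw [Fin.lt_def]; omega
  simp [offDiagonalCoeff, this, fst_deformedWeight, fst_algebraMap_dualNumber, h, pow_succ']

theorem offDiagonalCoeff_of_succ {r s : Fin e} (h : (s : ℕ) = r + 1) (hf : (s : ℕ) ≠ f)
    (he : (s : ℕ) + 1 ≠ e) : offDiagonalCoeff q (deformedWeight q f t) s r = 0 := by
  have h₁ : ¬ s < r := by rw [Fin.lt_def]; omega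
  have h₂ : weightSlope e f t s = weightSlope e f t r := by
    unfold weightSlope
    split_ifs <;> first | rfl | omega
  have h₃ : algebraMap K (DualNumber R) q * deformedWeight q f t r = deformedWeight q f t s := by
    ext
    · simp [fst_deformedWeight, fst_algebraMap_dualNumber, h, pow_succ']
    · rw [snd_mul, snd_deformedWeight, snd_deformedWeight, h₂]
      simp [fst_algebraMap_dualNumber, snd_algebraMap_dualNumber, h, pow_succ', mul_assoc]
  simp [offDiagonalCoeff, h₁, h₃]

theorem fst_offDiagonalCoeff_of_ends (hq : IsPrimitiveRoot q e) {r s : Fin e} (hr : (r : ℕ) = 0)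
    (hs : (s : ℕ) + 1 = e) : (offDiagonalCoeff q (deformedWeight q f t) s r).fst = 0 := by
  have h₁ : ¬ s < r := by rw [Fin.lt_def]; omega
  have h₂ : algebraMap K R q * algebraMap K R q ^ (s : ℕ) = 1 := by
    rw [← pow_succ', hs, ← map_pow, hq.pow_eq_one, map_one]
  simp [offDiagonalCoeff, h₁, fst_deformedWeight, fst_algebraMap_dualNumber, hr, h₂]

/-- The operators on functions of words attached to the deformed weights. -/
noncomputable def deformedRep (q : K) (e f : ℕ) (t : R) :
    ℕ → Module.End K (Equiv.Perm (Fin e) → DualNumber R) :=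
  wordRep K (deformedWeight q f t) (diagonalCoeff q (deformedWeight q f t))
    (offDiagonalCoeff q (deformedWeight q f t))

theorem deformedRep_mem (hq : IsPrimitiveRoot q e) (he : 3 ≤ e) (k : ℕ)
    (g : Equiv.Perm (Fin e) → DualNumber R) (hg : g ∈ orderedFunctions K R e f) :
    deformedRep q e f t k g ∈ orderedFunctions K R e f := by
  unfold deformedRep
  rcases k with _ | k
  · intro w
    rw [wordRep_zero (by omega), letterOperator_apply]
    exact ⟨fun hw => by simp [(hg w).1 hw], fun hw => by simp [(hg w).2 hw]⟩
  by_cases hk : k + 1 < e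
  swap
  · simp [wordRep, hk]
  rw [wordRep_succ hk]
  intro w
  rw [wordOperator_apply]
  set a : Fin e := ⟨k, by omega⟩ with ha
  set b : Fin e := ⟨k + 1, hk⟩ with hb
  constructor
  · intro hw
    rw [fst_add, fst_mul, fst_mul, (hg w).1 hw]
    by_cases hw' : w * Equiv.swap a b = 1
    · obtain rfl : w = Equiv.swap a b := by
        rw [← Equiv.swap_inv, eq_inv_of_mul_eq_one_left hw']
      rw [Equiv.swap_apply_left, Equiv.swap_apply_right, fst_offDiagonalCoeff_of_succ rfl]
      simp
    · rw [(hg _).1 hw']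
      simp
  · intro hw
    rw [(hg w).2 hw, mul_zero, zero_add]
    by_cases hw' : IsOrderedWord f (w * Equiv.swap a b)
    swap
    · rw [(hg _).2 hw', mul_zero]
    obtain ⟨r, s, hrs, hlt⟩ : ∃ r s, IsOrderedPair f r s ∧ ¬ w⁻¹ r < w⁻¹ s := by
      simpa [IsOrderedWord] using hw
    have h₁ := hw' r s hrs
    rw [mul_inv_rev, Equiv.swap_inv, Equiv.Perm.mul_apply, Equiv.Perm.mul_apply] at h₁
    have h₂ : w⁻¹ r ≠ w⁻¹ s := (w⁻¹).injective.ne (hrs.lt he).ne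
    have h₃ : w⁻¹ r = b ∧ w⁻¹ s = a := by
      generalize w⁻¹ r = i, w⁻¹ s = j at *
      rw [Equiv.swap_apply_def, Equiv.swap_apply_def] at h₁
      simp only [Fin.ext_iff, Fin.lt_def, ha, hb] at *
      split_ifs at h₁ <;> simp at h₁ <;> omega
    have h₄ : w a = s := by simp [← h₃.2]
    have h₅ : w b = r := by simp [← h₃.1]
    rw [h₄, h₅]
    rcases hrs with ⟨hr, hs⟩ | ⟨h₆, h₇, h₈⟩
    · refine mul_eq_zero_of_fst_eq_zero (fst_offDiagonalCoeff_of_ends hq hr hs) ((hg _).1 ?_)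
      intro hw''
      have : w = Equiv.swap a b := by
        rw [← Equiv.swap_inv, eq_inv_of_mul_eq_one_left hw'']
      rw [this, Equiv.swap_apply_left] at h₄
      rw [this, Equiv.swap_apply_right] at h₅
      rw [← h₄] at hs
      rw [← h₅] at hr
      simp [ha, hb] at hs hr
      omega
    · rw [offDiagonalCoeff_of_succ h₆ h₇ h₈, zero_mul]

theorem deformedWeight_quad {g : Equiv.Perm (Fin e) → DualNumber R} (he : 3 ≤ e) (hf : 2 * f ≤ e)
    (hg : g ∈ orderedFunctions K R e f) (w : Equiv.Perm (Fin e)) :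
    (deformedWeight q f t (w ⟨0, by omega⟩) - algebraMap K (DualNumber R) 1) *
      (deformedWeight q f t (w ⟨0, by omega⟩) - algebraMap K (DualNumber R) (q ^ f)) * g w = 0 := by
  by_cases hw : IsOrderedWord f w
  swap
  · rw [(hg w).2 hw, mul_zero]
  have h₀ : (deformedWeight q f t (w ⟨0, by omega⟩) - algebraMap K (DualNumber R) 1).fst = 0 ∨
      (w ⟨0, by omega⟩ : ℕ) = f := by
    refine (hw.apply_zero he).imp_left fun h => ?_
    simp [fst_deformedWeight, h]
  have h₁ : ∀ h : (w ⟨0, by omega⟩ : ℕ) = f,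
      (deformedWeight q f t (w ⟨0, by omega⟩) - algebraMap K (DualNumber R) (q ^ f)).fst = 0 := by
    intro h
    simp [fst_deformedWeight, h, fst_algebraMap_dualNumber]
  rcases f.eq_zero_or_pos with rfl | hf'
  · have h : (w ⟨0, by omega⟩ : ℕ) = 0 := (hw.apply_zero he).elim id id
    rw [mul_eq_zero_of_fst_eq_zero _ (h₁ h), zero_mul]
    simp [fst_deformedWeight, h]
  · rcases hw.apply_zero he with h | h
    · have : deformedWeight q f t (w ⟨0, by omega⟩) = 1 := by
        ext <;> simp [fst_deformedWeight, snd_deformedWeight, h, weightSlope, hf']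
      simp [this]
    · rw [mul_assoc, mul_eq_zero_of_fst_eq_zero (h₁ h) ((hg w).1 _), mul_zero]
      rintro rfl
      exact hf'.ne h

/-- The restriction of the operators attached to the deformed weights. -/
noncomputable def orderedRep (hq : IsPrimitiveRoot q e) (he : 3 ≤ e) (f : ℕ) (t : R) (k : ℕ) :
    Module.End K (orderedFunctions K R e f) :=
  (deformedRep q e f t k).restrict (deformedRep_mem hq he k)

variable (hq : IsPrimitiveRoot q e) (he : 3 ≤ e)

theorem isHeckeBRep_orderedRep (hf : 2 * f ≤ e) :
    IsHeckeBRep 1 (q ^ f) q e (orderedRep (R := R) hq he f t) :=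
  (isSeminormal_coeff q (isUnit_deformedWeight_sub_deformedWeight hq)).isHeckeBRep _ _
    fun _ _ hg w => deformedWeight_quad he hf hg w

theorem jucysMurphy_orderedRep {k : ℕ} (hk : k < e) (g : orderedFunctions K R e f)
    (w : Equiv.Perm (Fin e)) :
    (jucysMurphy q (orderedRep (R := R) hq he f t) k g).1 w =
      deformedWeight q f t (w ⟨k, hk⟩) * g.1 w := by
  have h₁ := map_jucysMurphy (T := orderedRep hq he f t) (T' := deformedRep q e f t) (e := e)
    (φ := (orderedFunctions K R e f).subtype) q (fun _ _ _ => rfl) k hk g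
  have h₂ := (isSeminormal_coeff q (isUnit_deformedWeight_sub_deformedWeight
    (R := R) (f := f) (t := t) hq)).jucysMurphy_wordRep (hq.ne_zero (by omega)) hk
  rw [deformedRep, h₂] at h₁
  exact congrFun h₁ w

theorem jucysMurphy_sub_orderedRep {k : ℕ} (hk : k < e) (g : orderedFunctions K R e f)
    (w : Equiv.Perm (Fin e)) :
    ((jucysMurphy q (orderedRep (R := R) hq he f t) k - q ^ k • 1) g).1 w =
      (deformedWeight q f t (w ⟨k, hk⟩) - algebraMap K (DualNumber R) (q ^ k)) * g.1 w := by
  rw [sub_mul, ← jucysMurphy_orderedRep hq he hk, ← Algebra.smul_def]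
  rfl

theorem fst_deformedWeight_sub_self {k : ℕ} (hk : k < e) :
    (deformedWeight q f t ⟨k, hk⟩ - algebraMap K (DualNumber R) (q ^ k)).fst = 0 := by
  simp [fst_deformedWeight, fst_algebraMap_dualNumber]

theorem jucysMurphy_sub_sq_orderedRep (k : Fin e) (g : orderedFunctions K R e f)
    (w : Equiv.Perm (Fin e)) :
    ((jucysMurphy q (orderedRep (R := R) hq he f t) k - q ^ (k : ℕ) • 1)
        ((jucysMurphy q (orderedRep (R := R) hq he f t) k - q ^ (k : ℕ) • 1) g)).1 w =
      (deformedWeight q f t (w k) - algebraMap K (DualNumber R) (q ^ (k : ℕ))) ^ 2 * g.1 w := by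
  rw [jucysMurphy_sub_orderedRep hq he k.2, jucysMurphy_sub_orderedRep hq he k.2]
  ring

theorem mem_trivialWeightSpace_orderedRep {g : orderedFunctions K R e f} :
    g ∈ trivialWeightSpace q e (orderedRep (R := R) hq he f t) ↔ ∀ w, w ≠ 1 → g.1 w = 0 := by
  simp only [trivialWeightSpace, Submodule.mem_iInf, LinearMap.mem_ker, pow_two,
    Module.End.mul_apply]
  constructor
  · intro hg w hw
    obtain ⟨k, hk⟩ : ∃ k, w k ≠ k := by
      by_contra! h
      exact hw (Equiv.ext h)
    have h₁ := jucysMurphy_sub_sq_orderedRep (t := t) hq he k g w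
    rw [hg k, Submodule.coe_zero, Pi.zero_apply] at h₁
    have h₂ := (isUnit_deformedWeight_sub (R := R) (f := f) (t := t) hq k.2
      (fun h => hk (Fin.ext h))).pow 2
    exact (h₂.mul_right_eq_zero).mp h₁.symm
  · intro hg k
    ext1
    funext w
    rw [jucysMurphy_sub_sq_orderedRep]
    by_cases hw : w = 1
    · rw [hw, pow_two, Equiv.Perm.one_apply, mul_eq_zero_of_fst_eq_zero
        (fst_deformedWeight_sub_self k.2) (fst_deformedWeight_sub_self k.2), zero_mul]
      rfl
    · rw [hg w hw, mul_zero]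
      rfl

/-- The function supported at the identity word with a given value. -/
def identityFunction (K : Type*) {R : Type*} [Field K] [CommRing R] [Algebra K R] {e : ℕ}
    (he : 3 ≤ e) (f : ℕ) (x : DualNumber R) : orderedFunctions K R e f :=
  ⟨Pi.single 1 x, fun w => ⟨fun hw => by simp [hw], fun hw => by
    rw [Pi.single_eq_of_ne]
    rintro rfl
    exact hw (isOrderedWord_one he)⟩⟩

theorem weightSlope_self (he : 3 ≤ e) (hf : 2 * f ≤ e) : weightSlope e f t f = 1 := by
  simp [weightSlope, (show f + 1 < e by omega)]

theorem weightSlope_last (he : 3 ≤ e) (hf : 2 * f ≤ e) : weightSlope e f t (e - 1) = t := by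
  simp [weightSlope, (show ¬ e - 1 < f by omega), (show ¬ e - 1 + 1 < e by omega)]

theorem pow_mul_fst_eq_zero (hf : 2 * f ≤ e) {k : ℕ} {g : orderedFunctions K R e f}
    (hg : g ∈ relationChain q e f (orderedRep (R := R) hq he f t) k) : t ^ k * (g.1 1).fst = 0 := by
  induction k generalizing g with
  | zero =>
    have : g = 0 := hg
    simp [this]
  | succ k ih =>
    obtain ⟨-, g', hg', h⟩ := hg
    have h₁ := congrArg (fun g : orderedFunctions K R e f => (g.1 1).snd) h
    simp only [jucysMurphy_sub_orderedRep hq he (by omega : f < e),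
      jucysMurphy_sub_orderedRep hq he (by omega : e - 1 < e), snd_mul, Equiv.Perm.one_apply,
      fst_deformedWeight_sub_self, snd_sub, snd_algebraMap_dualNumber, snd_deformedWeight,
      weightSlope_self he hf, weightSlope_last he hf] at h₁
    have h₂ : IsUnit (algebraMap K R (q ^ (e - 1))) :=
      (IsUnit.mk0 _ (pow_ne_zero _ (hq.ne_zero (by omega)))).map _
    have h₃ := ih hg'
    rw [← h₂.mul_right_eq_zero]
    simp at h₁
    simp only [map_pow]
    linear_combination algebraMap K R q ^ f * h₃ - t ^ k * h₁

theorem identityFunction_mem (hf : 2 * f ≤ e) {k : ℕ} {x : R} (hx : t ^ k * x = 0) :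
    identityFunction K he f (inl x) ∈ relationChain q e f (orderedRep (R := R) hq he f t) k := by
  induction k generalizing x with
  | zero =>
    have : x = 0 := by simpa using hx
    change _ = _
    ext1
    simp [this, identityFunction]
  | succ k ih =>
    refine ⟨(mem_trivialWeightSpace_orderedRep hq he).mpr fun w hw => Pi.single_eq_of_ne hw _,
      _, ih (x := algebraMap K R (q ^ (e - 1 - f)) * t * x) ?_, ?_⟩
    · linear_combination algebraMap K R (q ^ (e - 1 - f)) * hx
    ext1
    funext w
    rw [jucysMurphy_sub_orderedRep hq he (by omega : f < e),
      jucysMurphy_sub_orderedRep hq he (by omega : e - 1 < e)]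
    by_cases hw : w = 1
    · have h₁ : q ^ (e - 1) = q ^ f * q ^ (e - 1 - f) := by
        rw [← pow_add]
        congr 1
        omega
      have h₂ := congrArg (algebraMap K R) h₁
      rw [map_mul] at h₂
      subst hw
      ext
      · rw [fst_mul, fst_mul, Equiv.Perm.one_apply, Equiv.Perm.one_apply,
          fst_deformedWeight_sub_self, fst_deformedWeight_sub_self, zero_mul, zero_mul]
      · simp only [identityFunction, Pi.single_eq_same, snd_mul, fst_inl, snd_inl,
          Equiv.Perm.one_apply, fst_deformedWeight_sub_self, snd_sub, snd_algebraMap_dualNumber,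
          snd_deformedWeight, weightSlope_self he hf, weightSlope_last he hf, h₂]
        simp
        ring
    · simp [identityFunction, hw]

theorem not_relationChain_orderedRep_le (hf : 2 * f ≤ e) {d : ℕ} (ht : t ^ d ≠ 0)
    (ht' : t ^ (d + 1) = 0) : ¬ relationChain q e f (orderedRep (R := R) hq he f t) (d + 1) ≤
      relationChain q e f (orderedRep (R := R) hq he f t) d := by
  intro h
  have := pow_mul_fst_eq_zero hq he hf
    (h (identityFunction_mem hq he hf (x := 1) (by rw [mul_one, ht'])))
  exact ht (by simpa [identityFunction] using this)

end BaseCase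

section Assembly

variable {K : Type} [Field K]

theorem exists_finite_algebra_nilpotent (K : Type) [Field K] (d : ℕ) :
    ∃ (R : Type) (_ : CommRing R) (_ : Algebra K R) (_ : Module.Finite K R) (t : R),
      t ^ d ≠ 0 ∧ t ^ (d + 1) = 0 := by
  have hmonic : (Polynomial.X ^ (d + 1) : Polynomial K).Monic := Polynomial.monic_X_pow _
  refine ⟨AdjoinRoot (Polynomial.X ^ (d + 1) : Polynomial K), inferInstance, inferInstance,
    hmonic.finite_adjoinRoot, AdjoinRoot.root _, ?_, ?_⟩
  · rw [← AdjoinRoot.mk_X, ← map_pow, Ne, AdjoinRoot.mk_eq_zero,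
      pow_dvd_pow_iff Polynomial.X_ne_zero Polynomial.not_isUnit_X]
    omega
  · rw [← AdjoinRoot.mk_X, ← map_pow, AdjoinRoot.mk_self]

theorem exists_heckeBRep_relationChain {q : K} {e f : ℕ} (hq : IsPrimitiveRoot q e) (he : 3 ≤ e)
    (hf : 2 * f ≤ e) (d : ℕ) {n : ℕ} (hn : e ≤ n) :
    ∃ (M : Type) (_ : AddCommGroup M) (_ : Module K M) (_ : FiniteDimensional K M)
      (T : ℕ → Module.End K M), IsHeckeBRep 1 (q ^ f) q n T ∧
        ¬ relationChain q e f T (d + 1) ≤ relationChain q e f T d := by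
  induction n, hn using Nat.le_induction with
  | base =>
    obtain ⟨R, _, _, _, t, ht, ht'⟩ := exists_finite_algebra_nilpotent K d
    have : Module.Finite K (DualNumber R) := inferInstanceAs (Module.Finite K (R × R))
    exact ⟨orderedFunctions K R e f, inferInstance, inferInstance, inferInstance,
      orderedRep hq he f t, isHeckeBRep_orderedRep hq he hf,
      not_relationChain_orderedRep_le hq he hf ht ht'⟩
  | succ n hn ih =>
    obtain ⟨M, _, _, _, T, hT, hchain⟩ := ih
    exact ⟨boundedFamilies (K := K) M n, inferInstance, inferInstance, inferInstance,
      inducedRep 1 (q ^ f) q n T, hT.inducedRep,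
      fun h => hchain (relationChain_inducedRep (by omega) hn h)⟩

end Assembly

theorem heckeB_infinite_representation_type_of_e_le_n
    (K : Type) [Field K] (q : K) (e : ℕ) (hq : IsPrimitiveRoot q e) (he : 3 ≤ e)
    (f : ℕ) (hf : 2 * f ≤ e) (n : ℕ) (hn : e ≤ n) :
    ¬ HasFiniteRepresentationType K (HeckeB K 1 (q ^ f) q n) :=
  IsHeckeBRep.not_hasFiniteRepresentationType (by omega) hn fun d =>
    exists_heckeBRep_relationChain hq he hf d hn
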